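/- Let (R, 𝔪) be a local Noetherian ring, 𝔞 an ideal, M a nonzero finitely generated R-module of dimension d with H^d_𝔞(M) ≠ 0. Then Supp(H^d_𝔞(M)) ⊆ ∪ {V(𝔭 + 𝔞) : 𝔭 ∈ Ass_R(M), cd(𝔞, R/𝔭) = d}. -/

import Mathlib

open CategoryTheory

universe u

/-- `H^i_I(M) ≠ 0`: the `i`-th local cohomology of `M` with respect to `I` is nonzero. -/
abbrev LCNonzero {R : Type u} [CommRing R] (I : Ideal R) (i : ℕ)
    (M : Type u) [AddCommGroup M] [Module R M] : Prop :=
  Nontrivial ((localCohomology I i).obj (ModuleCat.of R M))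

/-- Cohomological dimension `cd(I, M) = sup {i : H^i_I(M) ≠ 0}`, as an element of
`WithBot ℕ∞` (it is `⊥` if all local cohomology of `M` vanishes). -/
noncomputable def cohDim {R : Type u} [CommRing R] (I : Ideal R)
    (M : Type u) [AddCommGroup M] [Module R M] : WithBot ℕ∞ :=
  sSup {n : WithBot ℕ∞ | ∃ i : ℕ, n = (i : ℕ∞) ∧ LCNonzero I i M}

/-- Krull dimension of a module, i.e. the Krull dimension of `R ⧸ Ann_R M`. -/
noncomputable def modDim (R : Type u) [CommRing R]
    (M : Type u) [AddCommGroup M] [Module R M] : WithBot ℕ∞ :=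
  ringKrullDim (R ⧸ Module.annihilator R M)

namespace LC
open CategoryTheory Limits Opposite

variable {R : Type u} [CommRing R]

/-- contravariant hom functor -/
noncomputable abbrev hF (Y : ModuleCat.{u} R) : ModuleCat.{u} R ⥤ (ModuleCat.{u} R)ᵒᵖ :=
  ((linearYoneda R (ModuleCat.{u} R)).obj Y).rightOp

/-- The hom complex in the opposite category. -/
noncomputable abbrev hK {X : ModuleCat.{u} R} (P : ProjectiveResolution X) (Y : ModuleCat.{u} R) :
    HomologicalComplex (ModuleCat.{u} R)ᵒᵖ (ComplexShape.down ℕ) :=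
  ((hF Y).mapHomologicalComplex (ComplexShape.down ℕ)).obj P.complex

/-- Ext module. -/
noncomputable abbrev E (i : ℕ) (X Y : ModuleCat.{u} R) : ModuleCat.{u} R :=
  ((Ext R (ModuleCat.{u} R) i).obj (op X)).obj Y

/-- derived functor iso -/
noncomputable def hI {X : ModuleCat.{u} R} (P : ProjectiveResolution X) (Y : ModuleCat.{u} R) (i : ℕ) :
    ((hF Y).leftDerived i).obj X ≅ (hK P Y).homology i :=
  P.isoLeftDerivedObj (hF Y) i

/-- Ext to opcycles -/
noncomputable def hJ {X : ModuleCat.{u} R} (P : ProjectiveResolution X) (Y : ModuleCat.{u} R) (i : ℕ) :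
    ((hF Y).leftDerived i).obj X ⟶ (hK P Y).opcycles i :=
  (hI P Y i).hom ≫ (hK P Y).homologyι i

instance {X : ModuleCat.{u} R} (P : ProjectiveResolution X) (Y : ModuleCat.{u} R) (i : ℕ) :
    Mono (hJ P Y i) := by
  unfold hJ; infer_instance

/-- map from cocycles to Ext. -/
noncomputable def toE {X : ModuleCat.{u} R} (P : ProjectiveResolution X) (Y : ModuleCat.{u} R) (i : ℕ) :
    ((hK P Y).opcycles i).unop ⟶ E i X Y :=
  (hJ P Y i).unop

/-- inclusion of cocycles. -/
noncomputable def toC {X : ModuleCat.{u} R} (P : ProjectiveResolution X) (Y : ModuleCat.{u} R) (i : ℕ) :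
    ((hK P Y).opcycles i).unop ⟶ ModuleCat.of R (P.complex.X i ⟶ Y) :=
  ((hK P Y).pOpcycles i).unop

/-- `f` represents `x`. -/
def Rep {X : ModuleCat.{u} R} (P : ProjectiveResolution X) {Y : ModuleCat.{u} R} {i : ℕ}
    (f : P.complex.X i ⟶ Y) (x : E i X Y) : Prop :=
  ∃ z, toC P Y i z = f ∧ toE P Y i z = x

lemma toE_surj {X : ModuleCat.{u} R} (P : ProjectiveResolution X) (Y : ModuleCat.{u} R) (i : ℕ) :
    Function.Surjective (toE P Y i) := by
  rw [← ModuleCat.epi_iff_surjective]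
  exact unop_epi_of_mono (hJ P Y i)

lemma toC_inj {X : ModuleCat.{u} R} (P : ProjectiveResolution X) (Y : ModuleCat.{u} R) (i : ℕ) :
    Function.Injective (toC P Y i) := by
  rw [← ModuleCat.mono_iff_injective]
  exact unop_mono_of_epi ((hK P Y).pOpcycles i)

lemma Rep.add {X : ModuleCat.{u} R} {P : ProjectiveResolution X} {Y : ModuleCat.{u} R} {i : ℕ}
    {f g : P.complex.X i ⟶ Y} {x y : E i X Y} (h : Rep P f x) (h' : Rep P g y) :
    Rep P (f + g) (x + y) := by
  obtain ⟨z, rfl, rfl⟩ := h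
  obtain ⟨w, rfl, rfl⟩ := h'
  exact ⟨z + w, map_add _ _ _, map_add _ _ _⟩

lemma Rep.smul {X : ModuleCat.{u} R} {P : ProjectiveResolution X} {Y : ModuleCat.{u} R} {i : ℕ}
    {f : P.complex.X i ⟶ Y} {x : E i X Y} (h : Rep P f x) (r : R) :
    Rep P (r • f) (r • x) := by
  obtain ⟨z, rfl, rfl⟩ := h
  exact ⟨r • z, map_smul (toC P Y i).hom _ _, map_smul (toE P Y i).hom _ _⟩

lemma Rep.unique {X : ModuleCat.{u} R} {P : ProjectiveResolution X} {Y : ModuleCat.{u} R} {i : ℕ}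
    {f : P.complex.X i ⟶ Y} {x y : E i X Y} (h : Rep P f x) (h' : Rep P f y) : x = y := by
  obtain ⟨z, rfl, rfl⟩ := h
  obtain ⟨w, h, rfl⟩ := h'
  rw [toC_inj _ _ _ h]

lemma Rep.zero {X : ModuleCat.{u} R} (P : ProjectiveResolution X) (Y : ModuleCat.{u} R) (i : ℕ) :
    Rep P (0 : P.complex.X i ⟶ Y) 0 := ⟨0, map_zero _, map_zero _⟩

lemma rep_cocycle_iff {X : ModuleCat.{u} R} {P : ProjectiveResolution X} {Y : ModuleCat.{u} R} {i : ℕ}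
    (f : P.complex.X i ⟶ Y) : P.complex.d (i + 1) i ≫ f = 0 ↔ ∃ x, Rep P f x := by
  have hex : (ShortComplex.mk _ _ ((hK P Y).d_pOpcycles (i+1) i)).Exact :=
    ShortComplex.exact_of_g_is_cokernel _ ((hK P Y).opcyclesIsCokernel (i+1) i (by simp))
  have h2 := (ShortComplex.moduleCat_exact_iff _).1 hex.unop
  constructor
  · intro hf
    obtain ⟨z, hz⟩ := h2 f hf
    exact ⟨_, z, hz, rfl⟩
  · rintro ⟨x, z, rfl, -⟩
    have := (ShortComplex.mk _ _ ((hK P Y).d_pOpcycles (i+1) i)).unop.zero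
    exact congrArg (fun k => k.hom z) this

lemma exists_rep {X : ModuleCat.{u} R} (P : ProjectiveResolution X) {Y : ModuleCat.{u} R} {i : ℕ}
    (x : E i X Y) : ∃ f, Rep P f x := by
  obtain ⟨z, rfl⟩ := toE_surj P Y i x
  exact ⟨_, z, rfl, rfl⟩

lemma rep_zero_iff {X : ModuleCat.{u} R} {P : ProjectiveResolution X} {Y : ModuleCat.{u} R} {i : ℕ}
    (f : P.complex.X (i+1) ⟶ Y) : Rep P f 0 ↔ ∃ g : P.complex.X i ⟶ Y, f = P.complex.d (i+1) i ≫ g := by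
  have hz : hJ P Y (i+1) ≫
      (hK P Y).fromOpcycles (i+1) i = 0 := by
    unfold hJ
    rw [Category.assoc, HomologicalComplex.homologyι_comp_fromOpcycles, comp_zero]
  have hex : (ShortComplex.mk _ _ hz).Exact := by
    refine ShortComplex.exact_of_iso ?_ (ShortComplex.exact_of_f_is_kernel (ShortComplex.mk _ _ ((hK P Y).homologyι_comp_fromOpcycles (i+1) i))
      ((hK P Y).homologyIsKernel (i+1) i (by simp)))
    exact ShortComplex.isoMk (hI P Y (i+1)).symm (Iso.refl _) (Iso.refl _)
      (show (hI P Y (i+1)).inv ≫ hJ P Y (i+1) = (hK P Y).homologyι (i+1) ≫ 𝟙 _ by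
        unfold hJ; rw [Iso.inv_hom_id_assoc, Category.comp_id])
      (show 𝟙 _ ≫ (hK P Y).fromOpcycles (i+1) i = (hK P Y).fromOpcycles (i+1) i ≫ 𝟙 _ by
        rw [Category.comp_id, Category.id_comp])
  have h2 := (ShortComplex.moduleCat_exact_iff _).1 hex.unop
  constructor
  · rintro ⟨z, rfl, h⟩
    obtain ⟨g, hg⟩ := h2 z h
    refine ⟨g, ?_⟩
    rw [← hg]
    have := (hK P Y).p_fromOpcycles (i+1) i
    exact congrArg (fun k => k.unop.hom g) this
  · rintro ⟨g, rfl⟩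
    refine ⟨((hK P Y).fromOpcycles (i+1) i).unop g, ?_, ?_⟩
    · have := (hK P Y).p_fromOpcycles (i+1) i
      exact congrArg (fun k => k.unop.hom g) this
    · exact congrArg (fun k => k.unop.hom g) hz

lemma rep_zero_iff_zero {X : ModuleCat.{u} R} {P : ProjectiveResolution X} {Y : ModuleCat.{u} R}
    (f : P.complex.X 0 ⟶ Y) : Rep P f 0 ↔ f = 0 := by
  constructor
  · rintro ⟨z, rfl, h⟩
    have : IsIso (toE P Y 0) := by
      have : IsIso ((hK P Y).homologyι 0) := by
        exact (hK P Y).isIso_homologyι 0 0 (by simp) (by simp)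
      have : IsIso (hJ P Y 0) := by unfold hJ; infer_instance
      exact isIso_unop (hJ P Y 0)
    have hi : Function.Injective (toE P Y 0) := (ModuleCat.mono_iff_injective _).1 inferInstance
    have : z = 0 := hi (by rw [h, map_zero])
    rw [this, map_zero]
  · rintro rfl
    exact Rep.zero _ _ _

lemma Rep.map_right {X : ModuleCat.{u} R} {P : ProjectiveResolution X} {Y Y' : ModuleCat.{u} R} {i : ℕ}
    {f : P.complex.X i ⟶ Y} {x : E i X Y} (h : Rep P f x) (φ : Y ⟶ Y') :
    Rep P (f ≫ φ) (((Ext R (ModuleCat.{u} R) i).obj (op X)).map φ x) := by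
  obtain ⟨z, rfl, rfl⟩ := h
  let α : hF Y' ⟶ hF Y := NatTrans.rightOp ((linearYoneda R (ModuleCat.{u} R)).map φ)
  let β : hK P Y' ⟶ hK P Y := (NatTrans.mapHomologicalComplex α _).app P.complex
  refine ⟨(HomologicalComplex.opcyclesMap β i).unop z, ?_, ?_⟩
  · have := HomologicalComplex.p_opcyclesMap β i
    exact congrArg (fun k => k.unop.hom z) this
  · have h1 : (NatTrans.leftDerived α i).app X ≫ hJ P Y i = hJ P Y' i ≫ HomologicalComplex.opcyclesMap β i := by
      have h0 : (NatTrans.leftDerived α i).app X ≫ (hI P Y i).hom =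
          (hI P Y' i).hom ≫ HomologicalComplex.homologyMap β i := by
        have := P.leftDerived_app_eq α i
        rw [← Category.assoc] at this
        exact (Iso.eq_comp_inv _).1 this
      unfold hJ
      rw [← Category.assoc, h0, Category.assoc, Category.assoc,
        HomologicalComplex.homologyι_naturality]
    exact (congrArg (fun k => k.unop.hom z) h1).symm

/-- augmentation -/
noncomputable def aug {X : ModuleCat.{u} R} (P : ProjectiveResolution X) : P.complex.X 0 ⟶ X := P.π.f 0

lemma Rep.map_left {X X' : ModuleCat.{u} R} {P : ProjectiveResolution X} {P' : ProjectiveResolution X'}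
    {Y : ModuleCat.{u} R} {i : ℕ}
    {f : P.complex.X i ⟶ Y} {x : E i X Y} (h : Rep P f x) (u : X' ⟶ X)
    (φ : P'.complex ⟶ P.complex) (comm : φ.f 0 ≫ aug P = aug P' ≫ u) :
    Rep P' (φ.f i ≫ f) (((Ext R (ModuleCat.{u} R) i).map u.op).app Y x) := by
  obtain ⟨z, rfl, rfl⟩ := h
  let β : hK P' Y ⟶ hK P Y := ((hF Y).mapHomologicalComplex _).map φ
  refine ⟨(HomologicalComplex.opcyclesMap β i).unop z, ?_, ?_⟩
  · have := HomologicalComplex.p_opcyclesMap β i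
    exact congrArg (fun k => k.unop.hom z) this
  · have h1 : ((hF Y).leftDerived i).map u ≫ hJ P Y i = hJ P' Y i ≫ HomologicalComplex.opcyclesMap β i := by
      have h0 : ((hF Y).leftDerived i).map u ≫ (hI P Y i).hom =
          (hI P' Y i).hom ≫ HomologicalComplex.homologyMap β i :=
        ProjectiveResolution.isoLeftDerivedObj_hom_naturality u P' P φ comm (hF Y) i
      unfold hJ
      rw [← Category.assoc, h0, Category.assoc, Category.assoc,
        HomologicalComplex.homologyι_naturality]
    exact (congrArg (fun k => k.unop.hom z) h1).symm

end LC

namespace LC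
open CategoryTheory Limits Opposite

variable {R : Type u} [CommRing R] (I : Ideal R)

/-- quotient by power -/
noncomputable abbrev Q (t : ℕ) : ModuleCat.{u} R :=
  (localCohomology.ringModIdeals (localCohomology.idealPowersDiagram I)).obj (op t)

/-- transition -/
noncomputable abbrev tr {s t : ℕ} (h : t ≤ s) : Q I s ⟶ Q I t :=
  (localCohomology.ringModIdeals (localCohomology.idealPowersDiagram I)).map (homOfLE h).op

/-- resolution -/
noncomputable def PR (t : ℕ) : ProjectiveResolution (Q I t) := projectiveResolution _

/-- lifted transition -/
noncomputable def ltr {s t : ℕ} (h : t ≤ s) : (PR I s).complex ⟶ (PR I t).complex :=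
  ProjectiveResolution.lift (tr I h) (PR I s) (PR I t)

lemma ltr_comm {s t : ℕ} (h : t ≤ s) :
    (ltr I h).f 0 ≫ aug (PR I t) = aug (PR I s) ≫ tr I h :=
  ProjectiveResolution.lift_commutes_zero _ _ _

/-- local cohomology -/
noncomputable abbrev H (i : ℕ) (M : ModuleCat.{u} R) : ModuleCat.{u} R := (localCohomology I i).obj M

/-- structure map to colimit -/
noncomputable def mkH (i t : ℕ) (M : ModuleCat.{u} R) : E i (Q I t) M ⟶ H I i M :=
  (colimit.ι (localCohomology.diagram (localCohomology.idealPowersDiagram I) i) (op (op t))).app M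

/-- colimit cocone -/
noncomputable def isColim (i : ℕ) (M : ModuleCat.{u} R) := isColimitOfPreserves ((evaluation _ _).obj M)
  (colimit.isColimit (localCohomology.diagram (localCohomology.idealPowersDiagram I) i))

instance : PreservesFilteredColimitsOfSize.{0, 0} (forget (ModuleCat.{u} R)) :=
  preservesFilteredColimitsOfSize_shrink.{0, u, 0, u} _

lemma mkH_rep {i : ℕ} {M : ModuleCat.{u} R} (x : H I i M) : ∃ t e, mkH I i t M e = x := by
  obtain ⟨j, y, hy⟩ := Concrete.isColimit_exists_rep _ (isColim I i M) x
  exact ⟨j.unop.unop, y, hy⟩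

lemma mkH_tr {i s t : ℕ} (h : t ≤ s) {M : ModuleCat.{u} R} (e : E i (Q I t) M) :
    mkH I i s M (((Ext R (ModuleCat.{u} R) i).map (tr I h).op).app M e) = mkH I i t M e := by
  have := colimit.w (localCohomology.diagram (localCohomology.idealPowersDiagram I) i)
    (homOfLE h).op.op
  exact congrArg (fun k => (k.app M).hom e) this

lemma mkH_eq_zero {i t : ℕ} {M : ModuleCat.{u} R} (e : E i (Q I t) M) (he : mkH I i t M e = 0) :
    ∃ s, ∃ h : t ≤ s, ((Ext R (ModuleCat.{u} R) i).map (tr I h).op).app M e = 0 := by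
  have h0 : mkH I i t M e = mkH I i t M 0 := by rw [he, map_zero]
  obtain ⟨k, f, g, hk⟩ := Concrete.isColimit_exists_of_rep_eq _ (isColim I i M) e
    (0 : E i (Q I t) M) h0
  refine ⟨k.unop.unop, leOfHom f.unop.unop, ?_⟩
  refine Eq.trans hk ?_
  exact map_zero (ModuleCat.Hom.hom _)

/-- representation of local cohomology class -/
def RepH {i : ℕ} {M : ModuleCat.{u} R} (t : ℕ) (f : (PR I t).complex.X i ⟶ M) (x : H I i M) : Prop :=
  ∃ e, Rep (PR I t) f e ∧ mkH I i t M e = x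

variable {I} {i t : ℕ} {M : ModuleCat.{u} R}

lemma exists_repH (x : H I i M) : ∃ t f, (PR I t).complex.d (i+1) i ≫ f = 0 ∧ RepH I t f x := by
  obtain ⟨t, e, rfl⟩ := mkH_rep I x
  obtain ⟨f, hf⟩ := exists_rep (PR I t) e
  exact ⟨t, f, (rep_cocycle_iff f).2 ⟨e, hf⟩, e, hf, rfl⟩

lemma RepH.of_cocycle (f : (PR I t).complex.X i ⟶ M) (hf : (PR I t).complex.d (i+1) i ≫ f = 0) :
    ∃ x, RepH I t f x := by
  obtain ⟨e, he⟩ := (rep_cocycle_iff f).1 hf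
  exact ⟨_, e, he, rfl⟩

lemma RepH.cocycle {f : (PR I t).complex.X i ⟶ M} {x : H I i M} (h : RepH I t f x) :
    (PR I t).complex.d (i+1) i ≫ f = 0 := by
  obtain ⟨e, he, -⟩ := h
  exact (rep_cocycle_iff f).2 ⟨e, he⟩

lemma RepH.tr {f : (PR I t).complex.X i ⟶ M} {x : H I i M} (h : RepH I t f x) {s : ℕ} (hs : t ≤ s) :
    RepH I s ((ltr I hs).f i ≫ f) x := by
  obtain ⟨e, he, rfl⟩ := h
  exact ⟨_, he.map_left _ _ (ltr_comm I hs), mkH_tr I hs e⟩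

lemma RepH.add {f g : (PR I t).complex.X i ⟶ M} {x y : H I i M} (h : RepH I t f x)
    (h' : RepH I t g y) : RepH I t (f + g) (x + y) := by
  obtain ⟨e, he, rfl⟩ := h
  obtain ⟨e', he', rfl⟩ := h'
  exact ⟨_, he.add he', map_add _ _ _⟩

lemma RepH.smul {f : (PR I t).complex.X i ⟶ M} {x : H I i M} (h : RepH I t f x) (r : R) :
    RepH I t (r • f) (r • x) := by
  obtain ⟨e, he, rfl⟩ := h
  exact ⟨_, he.smul r, map_smul (mkH I i t M).hom _ _⟩

lemma RepH.sub {f g : (PR I t).complex.X i ⟶ M} {x y : H I i M} (h : RepH I t f x)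
    (h' : RepH I t g y) : RepH I t (f - g) (x - y) := by
  have := h.add (h'.smul (-1))
  rwa [neg_one_smul, neg_one_smul, ← sub_eq_add_neg, ← sub_eq_add_neg] at this

lemma RepH.unique {f : (PR I t).complex.X i ⟶ M} {x y : H I i M} (h : RepH I t f x)
    (h' : RepH I t f y) : x = y := by
  obtain ⟨e, he, rfl⟩ := h
  obtain ⟨e', he', rfl⟩ := h'
  rw [he.unique he']

lemma RepH.zero (t : ℕ) : RepH I t (0 : (PR I t).complex.X i ⟶ M) 0 :=
  ⟨0, Rep.zero _ _ _, map_zero _⟩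

lemma RepH.map {f : (PR I t).complex.X i ⟶ M} {x : H I i M} (h : RepH I t f x) {N : ModuleCat.{u} R}
    (φ : M ⟶ N) : RepH I t (f ≫ φ) ((localCohomology I i).map φ x) := by
  obtain ⟨e, he, rfl⟩ := h
  refine ⟨_, he.map_right φ, ?_⟩
  have := (colimit.ι (localCohomology.diagram (localCohomology.idealPowersDiagram I) i)
    (op (op t))).naturality φ
  exact congrArg (fun k => k.hom e) this

lemma RepH.coboundary (g : (PR I t).complex.X i ⟶ M) :
    RepH I t ((PR I t).complex.d (i+1) i ≫ g) 0 :=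
  ⟨0, (rep_zero_iff _).2 ⟨g, rfl⟩, map_zero _⟩

lemma RepH.exists_of_zero {f : (PR I t).complex.X (i+1) ⟶ M} (h : RepH I t f 0) :
    ∃ s, ∃ hs : t ≤ s, ∃ g : (PR I s).complex.X i ⟶ M,
      (ltr I hs).f (i+1) ≫ f = (PR I s).complex.d (i+1) i ≫ g := by
  obtain ⟨e, he, h0⟩ := h
  obtain ⟨s, hs, h1⟩ := mkH_eq_zero I e h0
  have := he.map_left _ _ (ltr_comm I hs)
  rw [h1] at this
  obtain ⟨g, hg⟩ := (rep_zero_iff _).1 this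
  exact ⟨s, hs, g, hg⟩

lemma RepH.exists_of_zero_zero {f : (PR I t).complex.X 0 ⟶ M} (h : RepH I t f 0) :
    ∃ s, ∃ hs : t ≤ s, (ltr I hs).f 0 ≫ f = 0 := by
  obtain ⟨e, he, h0⟩ := h
  obtain ⟨s, hs, h1⟩ := mkH_eq_zero I e h0
  have := he.map_left _ _ (ltr_comm I hs)
  rw [h1] at this
  exact ⟨s, hs, (rep_zero_iff_zero _).1 this⟩

/-- torsion -/
lemma pow_smul_eq_zero (x : H I i M) : ∃ t, ∀ r ∈ I ^ t, r • x = 0 := by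
  obtain ⟨t, f, -, e, he, rfl⟩ := exists_repH x
  refine ⟨t, fun r hr => ?_⟩
  have hq : r • 𝟙 (Q I t) = 0 := by
    ext y
    obtain ⟨y, rfl⟩ := Ideal.Quotient.mk_surjective y
    exact Ideal.Quotient.eq_zero_iff_mem.2 (Ideal.mul_mem_right _ _ hr)
  have h1 := he.map_left (P' := PR I t) 0 0 (by rw [comp_zero, HomologicalComplex.zero_f, zero_comp])
  have h2 := he.map_left (P' := PR I t) 0 (r • 𝟙 _) (by
    rw [comp_zero, HomologicalComplex.smul_f_apply, HomologicalComplex.id_f, Linear.smul_comp,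
      Category.id_comp, ← Category.comp_id (aug (PR I t)), ← Linear.comp_smul, hq, comp_zero])
  have h3 : Rep (PR I t) (r • f) (((Ext R (ModuleCat.{u} R) i).map (0 : Q I t ⟶ Q I t).op).app M e) := by
    simpa using h2
  have h4 : Rep (PR I t) 0 (((Ext R (ModuleCat.{u} R) i).map (0 : Q I t ⟶ Q I t).op).app M e) := by
    simpa using h1
  have h5 := h4.unique (Rep.zero _ _ _)
  rw [h5] at h3
  have h6 := h3.unique (he.smul r)
  rw [← map_smul (mkH I i t M).hom, ← h6, map_zero]

lemma smul_eq_zero_of_annihilator (r : R) (hr : ∀ m : M, r • m = 0) (x : H I i M) : r • x = 0 := by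
  obtain ⟨t, f, -, h⟩ := exists_repH x
  have h1 := h.smul r
  have : r • f = 0 := by
    ext y
    exact hr _
  rw [this] at h1
  exact h1.unique (RepH.zero t)

end LC

namespace LC
open CategoryTheory Limits Opposite

variable {R : Type u} [CommRing R] {I : Ideal R} {i t : ℕ} {M : ModuleCat.{u} R}

instance (t i : ℕ) : Projective ((PR I t).complex.X i) := (PR I t).projective i

lemma lift_of_zero {B C : ModuleCat.{u} R} (g : B ⟶ C) [Epi g] (h : (PR I t).complex.X i ⟶ C)
    (h0 : RepH I t h 0) : ∃ s, ∃ hs : t ≤ s, ∃ l : (PR I s).complex.X i ⟶ B,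
      (ltr I hs).f i ≫ h = l ≫ g ∧ RepH I s l 0 := by
  cases i with
  | zero =>
    obtain ⟨s, hs, h1⟩ := h0.exists_of_zero_zero
    exact ⟨s, hs, 0, by rw [h1, zero_comp], RepH.zero s⟩
  | succ j =>
    obtain ⟨s, hs, k, h1⟩ := h0.exists_of_zero
    refine ⟨s, hs, (PR I s).complex.d (j+1) j ≫ Projective.factorThru k g, ?_, RepH.coboundary _⟩
    rw [Category.assoc, Projective.factorThru_comp, h1]

variable {S : ShortComplex (ModuleCat.{u} R)}

lemma half_exact (hS : S.ShortExact) (x : H I i S.X₂) (hx : (localCohomology I i).map S.g x = 0) :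
    ∃ y, (localCohomology I i).map S.f y = x := by
  have := hS.mono_f
  have := hS.epi_g
  obtain ⟨t, k, hk, hkx⟩ := exists_repH x
  have h1 := hkx.map S.g
  rw [hx] at h1
  obtain ⟨s, hs, l, hl, hl0⟩ := lift_of_zero S.g _ h1
  have h2 := (hkx.tr hs).sub hl0
  rw [sub_zero] at h2
  have h3 : ((ltr I hs).f i ≫ k - l) ≫ S.g = 0 := by
    rw [Preadditive.sub_comp, Category.assoc, hl, sub_self]
  obtain ⟨m, hm⟩ : ∃ m, m ≫ S.f = (ltr I hs).f i ≫ k - l :=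
    ⟨hS.exact.lift _ h3, hS.exact.lift_f _ _⟩
  have hmc : (PR I s).complex.d (i+1) i ≫ m = 0 := by
    rw [← cancel_mono S.f, Category.assoc, hm, h2.cocycle, zero_comp]
  obtain ⟨y, hy⟩ := RepH.of_cocycle m hmc
  refine ⟨y, ?_⟩
  have h4 := hy.map S.f
  rw [hm] at h4
  exact h4.unique h2

lemma inj_of_surj (hS : S.ShortExact)
    (hsurj : Function.Surjective ((localCohomology I i).map S.g))
    (x : H I (i+1) S.X₁) (hx : (localCohomology I (i+1)).map S.f x = 0) : x = 0 := by
  have := hS.mono_f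
  have := hS.epi_g
  obtain ⟨t, k, hk, hkx⟩ := exists_repH x
  have h1 := hkx.map S.f
  rw [hx] at h1
  obtain ⟨s, hs, b, hb⟩ := h1.exists_of_zero
  have hkx' := hkx.tr hs
  set k' := (ltr I hs).f (i+1) ≫ k with hk'
  rw [← Category.assoc, ← hk'] at hb
  have hbc : (PR I s).complex.d (i+1) i ≫ (b ≫ S.g) = 0 := by
    rw [← Category.assoc, ← hb, Category.assoc, S.zero, comp_zero]
  obtain ⟨y, hy⟩ := RepH.of_cocycle _ hbc
  obtain ⟨w, rfl⟩ := hsurj y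
  obtain ⟨s', h, hhc, hh⟩ := exists_repH w
  have e1 := hy.tr (le_max_left s s')
  have e2 := (hh.tr (le_max_right s s'))
  have e3 := e1.sub (e2.map S.g)
  rw [sub_self] at e3
  obtain ⟨s3, h3, l, hl, hl0⟩ := lift_of_zero S.g _ e3
  have e4 := (e2.tr h3)
  set p := (ltr I h3).f i ≫ (ltr I (le_max_left s s')).f i ≫ b with hp
  set q := (ltr I h3).f i ≫ (ltr I (le_max_right s s')).f i ≫ h with hq
  have e5 : (p - q - l) ≫ S.g = 0 := by
    rw [Preadditive.sub_comp, ← hl, hp, hq]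
    simp only [Preadditive.sub_comp, Preadditive.comp_sub, Category.assoc, sub_self]
  obtain ⟨m, hm⟩ : ∃ m, m ≫ S.f = p - q - l :=
    ⟨hS.exact.lift _ e5, hS.exact.lift_f _ _⟩
  have e6 : (PR I s3).complex.d (i+1) i ≫ m =
      (ltr I h3).f (i+1) ≫ (ltr I (le_max_left s s')).f (i+1) ≫ k' := by
    rw [← cancel_mono S.f, Category.assoc, hm, Preadditive.comp_sub, Preadditive.comp_sub,
      e4.cocycle, hl0.cocycle, sub_zero, sub_zero, hp, Category.assoc, Category.assoc, hb,
      HomologicalComplex.Hom.comm_assoc, HomologicalComplex.Hom.comm_assoc]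
  have e7 := (hkx'.tr (le_max_left s s')).tr h3
  rw [← e6] at e7
  exact e7.unique (RepH.coboundary m)

lemma eq_zero_of_injective [Injective M] (x : H I (i+1) M) : x = 0 := by
  obtain ⟨t, f, hf, h⟩ := exists_repH x
  have hex := ((PR I t).complex_exactAt_succ i)
  rw [HomologicalComplex.exactAt_iff' _ (i+2) (i+1) i (by simp) (by simp)] at hex
  have := hex.comp_descToInjective f hf
  rw [← this] at h
  exact h.unique (RepH.coboundary _)

lemma subsingleton_of_subsingleton [Subsingleton M] : Subsingleton (H I i M) := by
  refine ⟨fun x y => ?_⟩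
  rw [← sub_eq_zero, ← one_smul R (x - y)]
  exact smul_eq_zero_of_annihilator 1 (fun m => Subsingleton.elim _ _) _

/-- every element is killed by a power of `I` -/
def Tors (I : Ideal R) (M : Type u) [AddCommGroup M] [Module R M] : Prop :=
  ∀ m : M, ∃ t, ∀ r ∈ I ^ t, r • m = 0

lemma surj_zero (hS : S.ShortExact) (hT : Tors I S.X₂) :
    Function.Surjective ((localCohomology I 0).map S.g) := by
  intro y
  have := hS.epi_g
  obtain ⟨t, k, hk, hky⟩ := exists_repH y
  have hex := (PR I t).exact₀
  have hc : Epi (aug (PR I t)) := inferInstanceAs (Epi ((PR I t).π.f 0))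
  obtain ⟨c, hc⟩ : ∃ c : Q I t ⟶ S.X₃, aug (PR I t) ≫ c = k :=
    ⟨hex.desc k hk, hex.g_desc _ _⟩
  obtain ⟨e, he⟩ := (ModuleCat.epi_iff_surjective S.g).1 inferInstance
    (c (Ideal.Quotient.mk (I ^ t) 1))
  obtain ⟨s', hs'⟩ := hT e
  let s := max t s'
  have hts : t ≤ s := le_max_left _ _
  let hh : Q I s ⟶ S.X₂ := ModuleCat.ofHom (Submodule.liftQ (I ^ s) (LinearMap.toSpanSingleton R _ e)
    (fun r hr => by
      simpa using hs' r (Ideal.pow_le_pow_right (le_max_right t s') hr)))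
  have h1 : hh ≫ S.g = tr I hts ≫ c := by
    ext z
    obtain ⟨z, rfl⟩ := Ideal.Quotient.mk_surjective z
    change S.g (z • e) = c (Ideal.Quotient.mk (I ^ t) z)
    refine (map_smul S.g.hom z e).trans ?_
    refine (congrArg (fun w => z • w) he).trans ?_
    refine (map_smul c.hom z _).symm.trans ?_
    refine congrArg c.hom ?_
    change Ideal.Quotient.mk (I ^ t) (z * 1) = _
    rw [mul_one]
  have hcc : (PR I s).complex.d 1 0 ≫ (aug (PR I s) ≫ hh) = 0 := by
    have := (PR I s).complex_d_comp_π_f_zero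
    rw [← Category.assoc]
    exact (congrArg (· ≫ hh) this).trans zero_comp
  obtain ⟨x, hx⟩ := RepH.of_cocycle _ hcc
  refine ⟨x, ?_⟩
  have h2 := hx.map S.g
  rw [Category.assoc, h1, ← Category.assoc, ← ltr_comm, Category.assoc, hc] at h2
  exact h2.unique (hky.tr hts)

end LC

namespace LC
open CategoryTheory Limits Opposite

variable {R : Type u} [CommRing R] {I : Ideal R}

/-- short complex of modules -/
abbrev sc {A B C : Type u} [AddCommGroup A] [AddCommGroup B] [AddCommGroup C]
    [Module R A] [Module R B] [Module R C] (f : A →ₗ[R] B) (g : B →ₗ[R] C)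
    (h : Function.Exact f g) : ShortComplex (ModuleCat.{u} R) :=
  ShortComplex.mk (ModuleCat.ofHom f) (ModuleCat.ofHom g) (by
    ext x
    exact h.apply_apply_eq_zero x)

lemma sc_exact {A B C : Type u} [AddCommGroup A] [AddCommGroup B] [AddCommGroup C]
    [Module R A] [Module R B] [Module R C] {f : A →ₗ[R] B} {g : B →ₗ[R] C}
    (h : Function.Exact f g) (hf : Function.Injective f) (hg : Function.Surjective g) :
    (sc f g h).ShortExact where
  exact := (ShortComplex.ShortExact.moduleCat_exact_iff_function_exact _).2 h
  mono_f := (ModuleCat.mono_iff_injective _).2 hf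
  epi_g := (ModuleCat.epi_iff_surjective _).2 hg

/-- torsion submodule -/
def Gam (I : Ideal R) (E : Type u) [AddCommGroup E] [Module R E] : Submodule R E where
  carrier := {e | ∃ t, ∀ r ∈ I ^ t, r • e = 0}
  zero_mem' := ⟨0, fun r _ => smul_zero r⟩
  add_mem' := by
    rintro a b ⟨s, hs⟩ ⟨t, ht⟩
    refine ⟨max s t, fun r hr => ?_⟩
    rw [smul_add, hs r (Ideal.pow_le_pow_right (le_max_left s t) hr),
      ht r (Ideal.pow_le_pow_right (le_max_right s t) hr), add_zero]
  smul_mem' := by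
    rintro c a ⟨s, hs⟩
    refine ⟨s, fun r hr => ?_⟩
    rw [smul_comm, hs r hr, smul_zero]

lemma Gam_tors (E : Type u) [AddCommGroup E] [Module R E] : Tors I (Gam I E) := by
  rintro ⟨m, t, ht⟩
  exact ⟨t, fun r hr => Subtype.ext (ht r hr)⟩

lemma Tors.of_surj {A B : Type u} [AddCommGroup A] [AddCommGroup B] [Module R A] [Module R B]
    (hA : Tors I A) (f : A →ₗ[R] B) (hf : Function.Surjective f) : Tors I B := by
  intro b
  obtain ⟨a, rfl⟩ := hf b
  obtain ⟨t, ht⟩ := hA a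
  exact ⟨t, fun r hr => by rw [← map_smul, ht r hr, map_zero]⟩

lemma unif {A B : Type u} [AddCommGroup A] [AddCommGroup B] [Module R A] [Module R B]
    [Module.Finite R A] (hB : Tors I B) (f : A →ₗ[R] B) : ∃ t, ∀ r ∈ I ^ t, ∀ a, r • f a = 0 := by
  obtain ⟨s, hs⟩ := Module.Finite.fg_top (R := R) (M := A)
  choose T hT using hB
  refine ⟨s.sup (fun a => T (f a)), fun r hr a => ?_⟩
  have ha : a ∈ Submodule.span R (s : Set A) := hs ▸ Submodule.mem_top
  induction ha using Submodule.span_induction with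
  | mem x hx => exact hT (f x) r (Ideal.pow_le_pow_right (Finset.le_sup (f := fun a => T (f a)) hx) hr)
  | zero => simp
  | add x y _ _ hx hy => rw [map_add, smul_add, hx, hy, add_zero]
  | smul c x _ hx => rw [map_smul, smul_comm, hx, smul_zero]

lemma Gam_inj [IsNoetherianRing R] (E : Type u) [AddCommGroup E] [Module R E]
    [Module.Injective R E] : Module.Injective R (Gam I E) := by
  refine Module.Baer.injective ?_
  intro J g
  obtain ⟨t, ht⟩ := unif (Gam_tors E) g
  obtain ⟨k, hk⟩ := Ideal.exists_pow_inf_eq_pow_smul I (J : Submodule R R)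
  have hk := hk (k + t) (Nat.le_add_right _ _)
  rw [Nat.add_sub_cancel_left] at hk
  have h1 : I ^ t • (J : Submodule R R) ≤ (LinearMap.ker g).map J.subtype := by
    refine Submodule.smul_le.2 fun r hr j hj => ?_
    refine ⟨r • ⟨j, hj⟩, ?_, rfl⟩
    exact LinearMap.mem_ker.2 (by rw [map_smul, ht r hr])
  let φ : J →ₗ[R] R ⧸ I ^ (k + t) := (I ^ (k + t)).mkQ ∘ₗ J.subtype
  have h2 : LinearMap.ker φ ≤ LinearMap.ker ((Gam I E).subtype ∘ₗ g) := by
    rintro ⟨x, hx⟩ hxk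
    have hx' : x ∈ I ^ (k + t) := (Submodule.Quotient.mk_eq_zero _).1 hxk
    have h3 : x ∈ (LinearMap.ker g).map J.subtype := by
      refine h1 ?_
      have h4 : x ∈ I ^ (k + t) • (⊤ : Submodule R R) ⊓ J := by
        refine ⟨?_, hx⟩
        simpa using hx'
      rw [hk] at h4
      exact Submodule.smul_mono le_rfl inf_le_right h4
    obtain ⟨y, hy, hyx⟩ := h3
    have : y = ⟨x, hx⟩ := Subtype.ext hyx
    subst this
    rw [LinearMap.mem_ker, LinearMap.comp_apply, LinearMap.mem_ker.1 hy, map_zero]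
  obtain ⟨h, hh⟩ := Module.Injective.out (Q := E) ((LinearMap.ker φ).liftQ φ le_rfl)
    (LinearMap.ker_eq_bot.1 (Submodule.ker_liftQ_eq_bot _ _ _ le_rfl))
    ((LinearMap.ker φ).liftQ _ h2)
  refine ⟨LinearMap.codRestrict (Gam I E) (h ∘ₗ (I ^ (k + t)).mkQ) fun c => ⟨k + t, fun r hr => ?_⟩,
    fun x hx => Subtype.ext ?_⟩
  · rw [← map_smul]
    have : r • c ∈ I ^ (k + t) := Ideal.mul_mem_right _ _ hr
    rw [LinearMap.comp_apply, Submodule.mkQ_apply, (Submodule.Quotient.mk_eq_zero _).2 this, map_zero]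
  · exact hh (Submodule.Quotient.mk ⟨x, hx⟩)

lemma tors_vanish [IsNoetherianRing R] (i : ℕ) : ∀ (M : Type u) [AddCommGroup M] [Module R M],
    Tors I M → Subsingleton (H I (i+1) (ModuleCat.of R M)) := by
  induction i with
  | zero =>
    intro M _ _ hM
    let E := Injective.under (ModuleCat.of R M)
    have hE : Module.Injective R E := 
      Module.injective_module_of_injective_object R E (inj := inferInstanceAs (Injective (Injective.under (ModuleCat.of R M))))
    have hG := Gam_inj (I := I) E
    have hG' : Injective (ModuleCat.of R (Gam I E)) := Module.injective_object_of_injective_module R _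
    let ι : M →ₗ[R] E := (Injective.ι (ModuleCat.of R M)).hom
    have hι : Function.Injective ι := (ModuleCat.mono_iff_injective (Injective.ι (ModuleCat.of R M))).1 inferInstance
    let f : M →ₗ[R] Gam I E := ι.codRestrict _ fun m => by
      obtain ⟨t, ht⟩ := hM m
      exact ⟨t, fun r hr => by rw [← map_smul, ht r hr, map_zero]⟩
    have hf : Function.Injective f := fun a b hab => hι (congrArg Subtype.val hab)
    have hS := sc_exact (LinearMap.exact_map_mkQ_range f) hf (Submodule.mkQ_surjective _)
    refine subsingleton_of_forall_eq 0 fun x => ?_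
    exact inj_of_surj hS (surj_zero hS (Gam_tors E)) x (eq_zero_of_injective (M := ModuleCat.of R (Gam I E)) _)
  | succ i ih =>
    intro M _ _ hM
    let E := Injective.under (ModuleCat.of R M)
    have hE : Module.Injective R E := 
      Module.injective_module_of_injective_object R E (inj := inferInstanceAs (Injective (Injective.under (ModuleCat.of R M))))
    have hG := Gam_inj (I := I) E
    have hG' : Injective (ModuleCat.of R (Gam I E)) := Module.injective_object_of_injective_module R _
    let ι : M →ₗ[R] E := (Injective.ι (ModuleCat.of R M)).hom
    have hι : Function.Injective ι := (ModuleCat.mono_iff_injective (Injective.ι (ModuleCat.of R M))).1 inferInstance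
    let f : M →ₗ[R] Gam I E := ι.codRestrict _ fun m => by
      obtain ⟨t, ht⟩ := hM m
      exact ⟨t, fun r hr => by rw [← map_smul, ht r hr, map_zero]⟩
    have hf : Function.Injective f := fun a b hab => hι (congrArg Subtype.val hab)
    have hS := sc_exact (LinearMap.exact_map_mkQ_range f) hf (Submodule.mkQ_surjective _)
    refine subsingleton_of_forall_eq 0 fun x => ?_
    have hC := ih (Gam I E ⧸ LinearMap.range f) ((Gam_tors E).of_surj _ (Submodule.mkQ_surjective _))
    exact inj_of_surj hS (fun y => ⟨0, Subsingleton.elim _ _⟩) x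
      (eq_zero_of_injective (M := ModuleCat.of R (Gam I E)) _)

end LC

namespace LC
open scoped Pointwise
open CategoryTheory Limits Opposite

variable {R : Type u} [CommRing R] {I : Ideal R}

lemma map_smul_id {i : ℕ} {M : ModuleCat.{u} R} (r : R) (x : H I i M) :
    (localCohomology I i).map (r • 𝟙 M) x = r • x := by
  obtain ⟨t, f, -, hf⟩ := exists_repH x
  have h1 := hf.map (r • 𝟙 M)
  rw [Linear.comp_smul, Category.comp_id] at h1
  exact h1.unique (hf.smul r)

lemma eq_zero_of_smul_inj {i : ℕ} {M : ModuleCat.{u} R} (r : R) (hr : r ∈ I)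
    (h : ∀ x : H I i M, r • x = 0 → x = 0) (x : H I i M) : x = 0 := by
  obtain ⟨t, ht⟩ := pow_smul_eq_zero x
  have h1 := ht (r ^ t) (Ideal.pow_mem_pow hr t)
  clear ht
  induction t with
  | zero => simpa using h1
  | succ t ih =>
    refine ih (h _ ?_)
    rw [smul_smul, ← pow_succ']
    exact h1

lemma minimalPrimes_ann {p : Ideal R} [p.IsPrime] {N : Type u} [AddCommGroup N] [Module R N]
    (e : N ≃ₗ[R] R ⧸ p) : (Module.annihilator R N).minimalPrimes = {p} := by
  rw [e.annihilator_eq, Ideal.annihilator_quotient, Ideal.minimalPrimes_eq_subsingleton_self]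

lemma supportDim_quot_lt [IsNoetherianRing R] {p : Ideal R} [p.IsPrime] {N : Type u} [AddCommGroup N]
    [Module R N] [Module.Finite R N]
    (e : N ≃ₗ[R] R ⧸ p) {r : R} (hr : r ∉ p) :
    Module.supportDim R (QuotSMulTop r N) + 1 ≤ Module.supportDim R N := by
  apply Module.supportDim_quotSMulTop_succ_le_of_notMem_minimalPrimes
  intro q hq
  rw [minimalPrimes_ann e] at hq
  rw [Set.mem_singleton_iff.1 hq]
  exact hr

lemma regular_quot {p : Ideal R} [p.IsPrime] {N : Type u} [AddCommGroup N]
    [Module R N] (e : N ≃ₗ[R] R ⧸ p) {r : R} (hr : r ∉ p) (n : N) (h : r • n = 0) : n = 0 := by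
  have h1 : r • e n = 0 := by rw [← map_smul, h, map_zero]
  obtain ⟨y, hy⟩ := Ideal.Quotient.mk_surjective (e n)
  rw [← hy] at h1
  have h2 : Ideal.Quotient.mk p (r * y) = 0 := h1
  have h3 := (Ideal.IsPrime.mem_or_mem ‹_› (Ideal.Quotient.eq_zero_iff_mem.1 h2)).resolve_left hr
  rw [Ideal.Quotient.eq_zero_iff_mem.2 h3] at hy
  exact e.map_eq_zero_iff.1 hy.symm

lemma grothendieck [IsNoetherianRing R] (n : ℕ) : ∀ (N : Type u) [AddCommGroup N] [Module R N]
    [Module.Finite R N], Module.supportDim R N < ((n : ℕ∞) : WithBot ℕ∞) → ∀ i, n ≤ i →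
    Subsingleton (H I i (ModuleCat.of R N)) := by
  induction n with
  | zero =>
    intro N _ _ _ h i _
    have h1 : Subsingleton N := by
      rw [← Module.supportDim_eq_bot_iff_subsingleton R]
      by_contra hb
      obtain ⟨a, ha⟩ := WithBot.ne_bot_iff_exists.1 hb
      rw [← ha] at h
      have h5 := WithBot.coe_lt_coe.1 h
      simp at h5
    have : Subsingleton (ModuleCat.of R N) := h1
    exact subsingleton_of_subsingleton
  | succ n ih =>
    intro N _ _ hN
    refine IsNoetherianRing.induction_on_isQuotientEquivQuotientPrime R hN
      (motive := fun N _ _ _ => Module.supportDim R N < (((n + 1 : ℕ) : ℕ∞) : WithBot ℕ∞) →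
        ∀ i, n + 1 ≤ i → Subsingleton (H I i (ModuleCat.of R N))) ?_ ?_ ?_
    · intro N _ _ _ hs _ i _
      have : Subsingleton (ModuleCat.of R N) := hs
      exact subsingleton_of_subsingleton
    · intro N _ _ _ p e hdim i hi
      obtain ⟨j, rfl⟩ : ∃ j, i = j + 1 := ⟨i - 1, by omega⟩
      have hp := p.2
      by_cases hIp : I ≤ p.1
      · refine tors_vanish j N fun m => ⟨1, fun r hr => ?_⟩
        rw [pow_one] at hr
        apply e.injective
        rw [map_smul, map_zero]
        obtain ⟨y, hy⟩ := Ideal.Quotient.mk_surjective (e m)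
        rw [← hy]
        exact Ideal.Quotient.eq_zero_iff_mem.2 (p.1.mul_mem_right y (hIp hr))
      · obtain ⟨r, hrI, hrp⟩ := SetLike.not_le_iff_exists.1 hIp
        have hd := supportDim_quot_lt e hrp
        have hlt : Module.supportDim R (QuotSMulTop r N) < ((n : ℕ∞) : WithBot ℕ∞) := by
          by_contra hcon
          rw [not_lt] at hcon
          have h2 := add_le_add_left hcon 1
          have h3 := (h2.trans hd).trans_lt hdim
          exact lt_irrefl (((n : ℕ∞) : WithBot ℕ∞) + 1) h3
        have hq := ih (QuotSMulTop r N) hlt j (by omega)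
        let f : N →ₗ[R] N := r • LinearMap.id
        have hex : Function.Exact f (Submodule.mkQ (r • (⊤ : Submodule R N))) := by
          intro y
          rw [Submodule.mkQ_apply, Submodule.Quotient.mk_eq_zero]
          constructor
          · rintro ⟨z, -, rfl⟩
            exact ⟨z, rfl⟩
          · rintro ⟨z, rfl⟩
            exact ⟨z, trivial, rfl⟩
        have hf : Function.Injective f :=
          (injective_iff_map_eq_zero f).2 fun a ha => regular_quot e hrp a ha
        have hS := sc_exact hex hf (Submodule.mkQ_surjective _)
        refine subsingleton_of_forall_eq 0 ?_
        refine eq_zero_of_smul_inj r hrI fun x hx => ?_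
        refine inj_of_surj hS (fun y => ⟨0, hq.elim _ _⟩) x ?_
        rw [← map_smul_id] at hx
        exact hx
    · intro N₁ _ _ _ N₂ _ _ _ N₃ _ _ _ f g hf hg hfg h1 h3 hdim i hi
      have a1 := h1 ((Module.supportDim_le_of_injective f hf).trans_lt hdim) i hi
      have a3 := h3 ((Module.supportDim_le_of_surjective g hg).trans_lt hdim) i hi
      refine subsingleton_of_forall_eq 0 fun x => ?_
      obtain ⟨y, rfl⟩ := half_exact (sc_exact hfg hf hg) x (a3.elim _ _)
      rw [a1.elim y 0]
      exact map_zero (ModuleCat.Hom.hom _)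

lemma exists_prime [IsNoetherianRing R] (J : Ideal R) (d : ℕ) (q : PrimeSpectrum R) (N : Type u)
    [AddCommGroup N] [Module R N] [hN : Module.Finite R N] :
    J ≤ Module.annihilator R N → q ∈ Module.support R (H I d (ModuleCat.of R N)) →
    ∃ p : PrimeSpectrum R, J ≤ p.1 ∧ q ∈ Module.support R (H I d (ModuleCat.of R (R ⧸ p.1))) := by
  refine IsNoetherianRing.induction_on_isQuotientEquivQuotientPrime R hN
      (motive := fun N _ _ _ => J ≤ Module.annihilator R N →
        q ∈ Module.support R (H I d (ModuleCat.of R N)) →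
    ∃ p : PrimeSpectrum R, J ≤ p.1 ∧ q ∈ Module.support R (H I d (ModuleCat.of R (R ⧸ p.1)))) ?_ ?_ ?_
  · intro N _ _ _ hs _ hq
    have : Subsingleton (ModuleCat.of R N) := hs
    have := subsingleton_of_subsingleton (I := I) (i := d) (M := ModuleCat.of R N)
    rw [Module.support_eq_empty] at hq
    exact hq.elim
  · intro N _ _ _ p e hJ hq
    refine ⟨p, ?_, ?_⟩
    · rwa [e.annihilator_eq, Ideal.annihilator_quotient] at hJ
    · have e' := ((localCohomology I d).mapIso e.toModuleIso).toLinearEquiv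
      rwa [e'.support_eq] at hq
  · intro N₁ _ _ _ N₂ _ _ _ N₃ _ _ _ f g hf hg hfg h1 h3 hJ hq
    have hS := sc_exact hfg hf hg
    by_cases hq3 : q ∈ Module.support R (H I d (ModuleCat.of R N₃))
    · exact h3 (hJ.trans (g.annihilator_le_of_surjective hg)) hq3
    refine h1 (hJ.trans (f.annihilator_le_of_injective hf)) ?_
    rw [Module.notMem_support_iff'] at hq3
    rw [Module.mem_support_iff'] at hq ⊢
    obtain ⟨m, hm⟩ := hq
    obtain ⟨r, hr, hr0⟩ := hq3 ((localCohomology I d).map (sc f g hfg).g m)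
    obtain ⟨y, hy⟩ := half_exact hS (r • m) (by
      refine (map_smul ((localCohomology I d).map (sc f g hfg).g).hom r m).trans hr0)
    refine ⟨y, fun s hs hsy => ?_⟩
    refine hm (s * r) (fun h => (q.2.mem_or_mem h).elim hs hr) ?_
    rw [mul_smul, ← hy]
    refine (map_smul ((localCohomology I d).map (sc f g hfg).f).hom s y).symm.trans ?_
    rw [hsy]
    exact map_zero (ModuleCat.Hom.hom _)

end LC

/-- Over a local ring, with `dim M = d` and `H^d_𝔞(M) ≠ 0`,
`Supp(H^d_𝔞(M)) ⊆ ⋃ {V(p + 𝔞) : p ∈ Ass_R M, cd(𝔞, R/p) = d}`. -/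
theorem stmt_15 {R : Type u} [CommRing R] [IsNoetherianRing R] [IsLocalRing R] (𝔞 : Ideal R)
    (M : Type u) [AddCommGroup M] [Module R M] [Module.Finite R M] [Nontrivial M]
    (d : ℕ) (hd : modDim R M = (d : ℕ∞)) (htop : LCNonzero 𝔞 d M) :
    Module.support R ((localCohomology 𝔞 d).obj (ModuleCat.of R M)) ⊆
      ⋃ p ∈ {p ∈ associatedPrimes R M | cohDim 𝔞 (R ⧸ p) = ((d : ℕ∞) : WithBot ℕ∞)},
        {q : PrimeSpectrum R | p + 𝔞 ≤ q.asIdeal} := by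
  intro q hq
  obtain ⟨p, hp, hqp⟩ := LC.exists_prime (I := 𝔞) (Module.annihilator R M) d q M le_rfl hq
  obtain ⟨p, hpp⟩ := p
  simp only at hp hqp
  have hnt : Nontrivial (LC.H 𝔞 d (ModuleCat.of R (R ⧸ p))) := by
    by_contra hcon
    rw [not_nontrivial_iff_subsingleton] at hcon
    rw [Module.support_eq_empty] at hqp
    exact hqp.elim
  -- dimension of `R ⧸ p0`
  have hle : ∀ p0 : Ideal R, Module.annihilator R M ≤ p0 →
      Module.supportDim R (R ⧸ p0) ≤ ((d : ℕ∞) : WithBot ℕ∞) := by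
    intro p0 h0
    unfold modDim at hd
    rw [← hd, ← Module.supportDim_quotient_eq_ringKrullDim]
    exact Module.supportDim_le_of_surjective (Submodule.factor h0) (Submodule.factor_surjective h0)
  have hge : ((d : ℕ∞) : WithBot ℕ∞) ≤ Module.supportDim R (R ⧸ p) := by
    by_contra hcon
    rw [not_le] at hcon
    have := LC.grothendieck (I := 𝔞) d (R ⧸ p) hcon d le_rfl
    exact not_subsingleton _ this
  have hmin : p ∈ (Module.annihilator R M).minimalPrimes := by
    refine ⟨⟨hpp, hp⟩, ?_⟩
    rintro p0 ⟨hp0, h0⟩ h0p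
    by_contra hcon
    obtain ⟨r, hr, hr0⟩ := SetLike.not_le_iff_exists.1 hcon
    have h1 := LC.supportDim_quot_lt (LinearEquiv.refl R (R ⧸ p0)) hr0
    let f : QuotSMulTop r (R ⧸ p0) →ₗ[R] R ⧸ p :=
      Submodule.liftQ _ (Submodule.factor h0p) (by
        rintro _ ⟨y, -, rfl⟩
        rw [LinearMap.mem_ker]
        refine (map_smul (Submodule.factor h0p) r y).trans ?_
        obtain ⟨z, hz⟩ := Ideal.Quotient.mk_surjective (Submodule.factor h0p y)
        rw [← hz]
        exact Ideal.Quotient.eq_zero_iff_mem.2 (p.mul_mem_right z hr))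
    have hf : Function.Surjective f := by
      intro y
      obtain ⟨z, hz⟩ := Submodule.factor_surjective h0p y
      exact ⟨Submodule.Quotient.mk z, hz⟩
    have h2 := hge.trans (Module.supportDim_le_of_surjective f hf)
    have h3 := ((add_le_add_left h2 1).trans h1).trans (hle p0 h0)
    have h4 : (((d : ℕ∞) + 1 : ℕ∞) : WithBot ℕ∞) ≤ ((d : ℕ∞) : WithBot ℕ∞) := h3
    rw [WithBot.coe_le_coe] at h4
    have h5 : d + 1 ≤ d := by exact_mod_cast h4
    omega
  have hcd : cohDim 𝔞 (R ⧸ p) = ((d : ℕ∞) : WithBot ℕ∞) := by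
    unfold cohDim
    refine le_antisymm (sSup_le ?_) (le_sSup ⟨d, rfl, hnt⟩)
    rintro _ ⟨i, rfl, hi⟩
    by_contra hcon
    rw [not_le, WithBot.coe_lt_coe] at hcon
    have hdi : d < i := by exact_mod_cast hcon
    have := LC.grothendieck (I := 𝔞) i (R ⧸ p) ((hle p hp).trans_lt (WithBot.coe_lt_coe.2 hcon)) i le_rfl
    exact not_nontrivial_iff_subsingleton.2 this hi
  simp only [Set.mem_iUnion]
  refine ⟨p, ⟨Module.associatedPrimes.minimalPrimes_annihilator_subset_associatedPrimes R M hmin, hcd⟩, ?_⟩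
  rw [Module.mem_support_iff'] at hqp
  obtain ⟨m, hm⟩ := hqp
  change p ⊔ 𝔞 ≤ q.asIdeal
  refine sup_le (fun r hr => ?_) (fun r hr => ?_)
  · by_contra hrq
    refine hm r hrq (LC.smul_eq_zero_of_annihilator r (fun z => ?_) m)
    obtain ⟨y, rfl⟩ := Ideal.Quotient.mk_surjective z
    exact Ideal.Quotient.eq_zero_iff_mem.2 (p.mul_mem_right y hr)
  · by_contra hrq
    obtain ⟨t, ht⟩ := LC.pow_smul_eq_zero m
    exact hm (r ^ t) (fun h => hrq (q.2.mem_of_pow_mem t h)) (ht _ (Ideal.pow_mem_pow hr t))
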